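/- Let (f_n) be the integer sequence defined by f_0 = 0, f_1 = 1 and f_n = Σ_{i=1}^{n−1} (2^i C_i − f_i) f_{n−i} for n ≥ 2, where C_i = (1/i)·binomial(2i−2, i−1), and let t_n = 2^n C_n − f_n (with t_0 = 0). Then t_n is asymptotically equivalent to ((3 + √3)/6) · 2^{3n−2}/√(π n³) as n → ∞; that is, t_n · 6 √(π n³) / ((3 + √3) · 2^{3n−2}) tends to 1 as n → ∞. -/

import Mathlib

/-- The Catalan number `C n = (1/n) * binomial (2n-2) (n-1)` (the division is exact;
`C 0 = 0`). -/
def catalanC (n : ℕ) : ℕ := (2 * n - 2).choose (n - 1) / n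

theorem catalanC_zero : catalanC 0 = 0 := by simp [catalanC]

theorem catalanC_succ (n : ℕ) : catalanC (n + 1) = catalan n := by
  rw [catalan_eq_centralBinom_div, Nat.centralBinom]
  simp [catalanC, mul_add]

theorem catalanC_succ_cast (n : ℕ) :
    (catalanC (n + 1) : ℝ) = n.centralBinom / (n + 1) := by
  rw [catalanC_succ, ← succ_mul_catalan_eq_centralBinom]
  push_cast
  field_simp

open PowerSeries in
/-- The generating function of `catalanC`. -/
noncomputable def catalanGF : ℝ⟦X⟧ := mk fun n => (catalanC n : ℝ)

open PowerSeries in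
/-- The generating function of `2 ^ n * catalanC n`. -/
noncomputable def rowsGF : ℝ⟦X⟧ := mk fun n => 2 ^ n * (catalanC n : ℝ)

open PowerSeries in
theorem catalanGF_eq : catalanGF = X + catalanGF ^ 2 := by
  have h : catalanGF = X * map (Nat.castRingHom ℝ) catalanSeries := by
    ext (_ | n)
    · simp [catalanGF, catalanC_zero]
    · rw [coeff_succ_X_mul]
      simp [catalanGF, catalanC_succ]
  have e := congrArg (map (Nat.castRingHom ℝ)) catalanSeries_sq_mul_X_add_one
  simp only [map_add, map_mul, map_pow, map_one, map_X] at e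
  rw [h]
  linear_combination (-X) * e

open PowerSeries in
theorem rowsGF_eq : rowsGF = 2 * X + rowsGF ^ 2 := by
  have h : rowsGF = rescale 2 catalanGF := by
    rw [catalanGF, rescale_mk, rowsGF]
  rw [h]
  conv_lhs => rw [catalanGF_eq]
  rw [map_add, map_pow, rescale_X]
  rfl

open PowerSeries in
theorem constantCoeff_rowsGF : constantCoeff rowsGF = 0 := by
  rw [← coeff_zero_eq_constantCoeff_apply]
  simp [rowsGF, catalanC_zero]

open PowerSeries in
theorem coeff_rowsGF_pow_nonneg (m n : ℕ) : 0 ≤ coeff n (rowsGF ^ m) := by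
  induction m generalizing n with
  | zero => rw [pow_zero, coeff_one]; split_ifs <;> norm_num
  | succ m ih =>
    rw [pow_succ, coeff_mul]
    refine Finset.sum_nonneg fun p _ => mul_nonneg (ih _) ?_
    rw [rowsGF, coeff_mk]
    positivity

open PowerSeries in
theorem coeff_rowsGF_pow_add_two (m n : ℕ) :
    coeff (n + 1) (rowsGF ^ (m + 2)) =
      coeff (n + 1) (rowsGF ^ (m + 1)) - 2 * coeff n (rowsGF ^ m) := by
  have h : rowsGF ^ (m + 2) = rowsGF ^ (m + 1) - X * (C (2 : ℝ) * rowsGF ^ m) := by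
    have e : (C (2 : ℝ) : ℝ⟦X⟧) = 2 := rfl
    rw [e]
    linear_combination (-rowsGF ^ m) * rowsGF_eq
  rw [h, map_sub, coeff_succ_X_mul, coeff_C_mul]

open PowerSeries in
theorem coeff_rowsGF_pow_succ_le (m n : ℕ) :
    coeff (n + 1) (rowsGF ^ (m + 1)) ≤ coeff (n + 1) rowsGF := by
  induction m with
  | zero => simp
  | succ m ih =>
    rw [coeff_rowsGF_pow_add_two]
    linarith [coeff_rowsGF_pow_nonneg m n]

open PowerSeries in
theorem coeff_rowsGF_succ (n : ℕ) :
    coeff (n + 1) rowsGF = 2 ^ (n + 1) * (n.centralBinom / (n + 1)) := by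
  rw [rowsGF, coeff_mk, catalanC_succ_cast]

open PowerSeries in
theorem coeff_rowsGF_succ_pos (n : ℕ) : 0 < coeff (n + 1) rowsGF := by
  rw [coeff_rowsGF_succ]
  have := n.centralBinom_pos
  positivity

theorem centralBinom_succ_cast (n : ℕ) :
    ((n + 1).centralBinom : ℝ) = 2 * (2 * n + 1) / (n + 1) * n.centralBinom := by
  have h : ((n : ℝ) + 1) * (n + 1).centralBinom = 2 * (2 * n + 1) * n.centralBinom :=
    mod_cast Nat.succ_mul_centralBinom_succ n
  field_simp
  linarith

open PowerSeries Filter Topology in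
theorem tendsto_coeff_rowsGF_ratio :
    Tendsto (fun n : ℕ => coeff (n + 1) rowsGF / coeff (n + 2) rowsGF) atTop (𝓝 (1 / 8)) := by
  have h : ∀ n : ℕ, coeff (n + 1) rowsGF / coeff (n + 2) rowsGF =
      (1 + 1 / ((n : ℝ) + 1)) / (8 - 4 * (1 / ((n : ℝ) + 1))) := by
    intro n
    have hp : (0 : ℝ) < n.centralBinom := mod_cast n.centralBinom_pos
    rw [coeff_rowsGF_succ, coeff_rowsGF_succ, centralBinom_succ_cast]
    have h1 : (8 - 4 * (1 / ((n : ℝ) + 1))) = 4 * (2 * n + 1) / (n + 1) := by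
      field_simp; ring
    rw [h1]
    push_cast
    field_simp
    ring
  simp_rw [h]
  have h0 := tendsto_one_div_add_atTop_nhds_zero_nat (𝕜 := ℝ)
  have := (tendsto_const_nhds (x := (1 : ℝ))).add h0
  have h8 := (tendsto_const_nhds (x := (8 : ℝ))).sub (h0.const_mul 4)
  convert! this.div h8 (by norm_num) using 2
  norm_num

open PowerSeries Filter Topology in
theorem tendsto_coeff_rowsGF_pow_div (m : ℕ) :
    Tendsto (fun n : ℕ => coeff (n + 1) (rowsGF ^ m) / coeff (n + 1) rowsGF) atTop
      (𝓝 (2 * m / 2 ^ m)) := by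
  induction m using Nat.twoStepInduction with
  | zero => simp [coeff_one]
  | one =>
    simp only [pow_one, div_self (coeff_rowsGF_succ_pos _).ne']
    simp
  | more m h0 h1 =>
    rw [← tendsto_add_atTop_iff_nat 1] at h1 ⊢
    have h := h1.sub ((h0.mul tendsto_coeff_rowsGF_ratio).const_mul 2)
    convert! h using 2 with n
    · rw [coeff_rowsGF_pow_add_two]
      have := (coeff_rowsGF_succ_pos n).ne'
      have := (coeff_rowsGF_succ_pos (n + 1)).ne'
      field_simp
    · push_cast
      field_simp
      ring

theorem sum_catalanC_div_four_pow (n : ℕ) :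
    ∑ k ∈ Finset.range (n + 1), (catalanC k : ℝ) / 4 ^ k =
      (1 - n.centralBinom / 4 ^ n) / 2 := by
  induction n with
  | zero => simp [catalanC_zero]
  | succ n ih =>
    rw [Finset.sum_range_succ, ih, catalanC_succ_cast, centralBinom_succ_cast]
    field_simp
    ring

theorem summable_catalanC_div_four_pow : Summable fun k => (catalanC k : ℝ) / 4 ^ k := by
  refine summable_of_sum_range_le (c := 1 / 2) (fun k => by positivity) fun n => ?_
  calc ∑ k ∈ Finset.range n, (catalanC k : ℝ) / 4 ^ k
      ≤ ∑ k ∈ Finset.range (n + 1), (catalanC k : ℝ) / 4 ^ k :=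
        Finset.sum_le_sum_of_subset_of_nonneg (Finset.range_mono n.le_succ)
          fun _ _ _ => by positivity
    _ ≤ 1 / 2 := by
        rw [sum_catalanC_div_four_pow]
        have : (0 : ℝ) ≤ n.centralBinom / 4 ^ n := by positivity
        linarith

open PowerSeries in
theorem sum_antidiagonal_centralBinom (n : ℕ) :
    ∑ p ∈ Finset.HasAntidiagonal.antidiagonal n, (p.1.centralBinom : ℝ) * p.2.centralBinom = 4 ^ n := by
  set D : ℝ⟦X⟧ := mk fun n => (n.centralBinom : ℝ) with hD
  have hd : derivative ℝ catalanGF = D := by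
    ext n
    rw [coeff_derivative, hD, coeff_mk, catalanGF, coeff_mk, catalanC_succ_cast]
    field_simp
  have h1 : D = 1 + 2 * catalanGF * D := by
    have := congrArg (derivative ℝ) catalanGF_eq
    rw [map_add, derivative_X, derivative_pow, hd] at this
    simpa using this
  have e4 : (C (4 : ℝ) : ℝ⟦X⟧) = 4 := rfl
  have h2 : D ^ 2 = 1 + X * (C (4 : ℝ) * D ^ 2) := by
    rw [e4]
    linear_combination (D - 2 * catalanGF * D + 1) * h1 + 4 * D ^ 2 * catalanGF_eq
  have h3 : coeff n (D ^ 2) = 4 ^ n := by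
    induction n with
    | zero => rw [h2]; simp
    | succ n ih => rw [h2, map_add, coeff_succ_X_mul, coeff_C_mul, ih, coeff_one]; simp [pow_succ']
  rw [← h3, sq, coeff_mul]
  simp [hD]

theorem summable_centralBinom_div_sixteen_pow :
    Summable fun n : ℕ => (n.centralBinom : ℝ) / 16 ^ n := by
  refine Summable.of_nonneg_of_le (fun n => by positivity) (fun n => ?_)
    (summable_geometric_of_lt_one (r := (1 / 4 : ℝ)) (by norm_num) (by norm_num))
  have h : (n.centralBinom : ℝ) ≤ 4 ^ n := mod_cast n.centralBinom_le_four_pow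
  calc (n.centralBinom : ℝ) / 16 ^ n ≤ 4 ^ n / 16 ^ n := by gcongr
    _ = (1 / 4) ^ n := by rw [← div_pow]; norm_num

theorem tsum_centralBinom_div_sixteen_pow :
    ∑' n : ℕ, (n.centralBinom : ℝ) / 16 ^ n = 2 / √3 := by
  have hs := summable_centralBinom_div_sixteen_pow
  have h := tsum_mul_tsum_eq_tsum_sum_antidiagonal_of_summable_norm hs.norm hs.norm
  have e : ∀ n : ℕ, ∑ p ∈ Finset.HasAntidiagonal.antidiagonal n,
      (p.1.centralBinom : ℝ) / 16 ^ p.1 * (p.2.centralBinom / 16 ^ p.2) = (1 / 4) ^ n := by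
    intro n
    rw [show (1 / 4 : ℝ) = 4 / 16 by norm_num, div_pow, ← sum_antidiagonal_centralBinom,
      Finset.sum_div]
    refine Finset.sum_congr rfl fun p hp => ?_
    rw [← Finset.HasAntidiagonal.mem_antidiagonal.mp hp, pow_add, div_mul_div_comm]
  simp_rw [e] at h
  rw [tsum_geometric_of_lt_one (by norm_num) (by norm_num)] at h
  rw [← sq_eq_sq₀ (tsum_nonneg fun n => by positivity) (by positivity), sq, h, div_pow,
    Real.sq_sqrt (by norm_num)]
  norm_num

theorem tsum_catalanC_div_four_pow_mul :
    ∑' k : ℕ, (catalanC k : ℝ) / 4 ^ k * (2 * (2 * k : ℕ) / 2 ^ (2 * k)) = √3 / 6 := by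
  have e : ∀ k : ℕ, (catalanC (k + 1) : ℝ) / 4 ^ (k + 1) *
      (2 * (2 * (k + 1) : ℕ) / 2 ^ (2 * (k + 1))) = 1 / 4 * (k.centralBinom / 16 ^ k) := by
    intro k
    rw [catalanC_succ_cast, pow_mul, show (16 : ℝ) = 4 * 4 by norm_num, mul_pow]
    push_cast
    norm_num
    field_simp
    ring
  have hs : Summable fun k : ℕ =>
      (catalanC k : ℝ) / 4 ^ k * (2 * (2 * k : ℕ) / 2 ^ (2 * k)) := by
    rw [← summable_nat_add_iff 1]
    simp_rw [e]
    exact summable_centralBinom_div_sixteen_pow.mul_left _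
  rw [hs.tsum_eq_zero_add]
  simp_rw [e]
  rw [tsum_mul_left, tsum_centralBinom_div_sixteen_pow, catalanC_zero]
  have : √3 ^ 2 = (3 : ℝ) := Real.sq_sqrt (by norm_num)
  field_simp
  rw [this]
  norm_num

open PowerSeries in
/-- A power series without constant term solving the quadratic equation of the `false` rows
is determined by the Catalan series. -/
theorem eq_sub_subst_catalanGF {F : ℝ⟦X⟧} (hF0 : constantCoeff F = 0)
    (hF : F = X + (rowsGF - F) * F) :
    F = C (1 / 2 : ℝ) * rowsGF - catalanGF.subst (C (1 / 4 : ℝ) * rowsGF ^ 2) := by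
  set w : ℝ⟦X⟧ := C (1 / 4 : ℝ) * rowsGF ^ 2 with hw
  have hw0 : constantCoeff w = 0 := by simp [hw, constantCoeff_rowsGF]
  have hsub : HasSubst w := HasSubst.of_constantCoeff_zero' hw0
  set S : ℝ⟦X⟧ := catalanGF.subst w with hS
  have hSeq : S = w + S ^ 2 := by
    rw [hS]
    conv_lhs => rw [catalanGF_eq]
    rw [subst_add hsub, subst_X hsub, subst_pow hsub]
  have hS0 : constantCoeff S = 0 := by
    apply constantCoeff_subst_eq_zero hw0
    rw [← coeff_zero_eq_constantCoeff_apply]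
    simp [catalanGF, catalanC_zero]
  set a : ℝ⟦X⟧ := C (1 / 2 : ℝ) with ha
  have ha2 : 2 * a = 1 := by
    have e2 : (2 : ℝ⟦X⟧) = C (2 : ℝ) := rfl
    rw [ha, e2, ← map_mul]
    norm_num
  have hw' : w = a ^ 2 * rowsGF ^ 2 := by
    rw [hw, ha, ← map_pow]
    norm_num
  have hprod : (F - (a * rowsGF - S)) * (1 - rowsGF + F + (a * rowsGF - S)) = 0 := by
    linear_combination hF + hSeq + hw' - a * rowsGF_eq + (rowsGF * S - X) * ha2
  rcases mul_eq_zero.mp hprod with h | h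
  · exact sub_eq_zero.mp h
  · have := congrArg constantCoeff h
    simp [constantCoeff_rowsGF, hF0, hS0] at this

open PowerSeries in
theorem coeff_subst_catalanGF (n : ℕ) :
    coeff n (catalanGF.subst (C (1 / 4 : ℝ) * rowsGF ^ 2)) =
      ∑' k : ℕ, (catalanC k : ℝ) / 4 ^ k * coeff n (rowsGF ^ (2 * k)) := by
  have hsub : HasSubst (C (1 / 4 : ℝ) * rowsGF ^ 2) :=
    HasSubst.of_constantCoeff_zero' (by simp [constantCoeff_rowsGF])
  have e : ∀ k : ℕ, coeff k catalanGF • coeff n ((C (1 / 4 : ℝ) * rowsGF ^ 2) ^ k) =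
      (catalanC k : ℝ) / 4 ^ k * coeff n (rowsGF ^ (2 * k)) := by
    intro k
    rw [mul_pow, ← map_pow, coeff_C_mul, ← pow_mul, catalanGF, coeff_mk, smul_eq_mul, one_div,
      inv_pow]
    ring
  have hfin := coeff_subst_finite' hsub catalanGF n
  rw [coeff_subst' hsub, ← tsum_eq_finsum (L := .unconditional ℕ) hfin]
  simp_rw [e]

open PowerSeries Filter Topology in
theorem tendsto_coeff_subst_catalanGF_div :
    Tendsto (fun n : ℕ => coeff (n + 1) (catalanGF.subst (C (1 / 4 : ℝ) * rowsGF ^ 2)) /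
      coeff (n + 1) rowsGF) atTop (𝓝 (√3 / 6)) := by
  simp_rw [coeff_subst_catalanGF, ← tsum_div_const, mul_div_assoc]
  rw [← tsum_catalanC_div_four_pow_mul]
  refine tendsto_tsum_of_dominated_convergence summable_catalanC_div_four_pow
    (fun k => (tendsto_coeff_rowsGF_pow_div (2 * k)).const_mul _) (Eventually.of_forall ?_)
  intro n k
  rcases k with _ | k
  · simp [catalanC_zero]
  have h0 := coeff_rowsGF_succ_pos n
  have h1 := coeff_rowsGF_pow_nonneg (2 * (k + 1)) (n + 1)
  rw [Real.norm_of_nonneg (by positivity)]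
  refine mul_le_of_le_one_right (by positivity) ((div_le_one h0).mpr ?_)
  exact coeff_rowsGF_pow_succ_le (2 * k + 1) n

open PowerSeries Filter Topology in
theorem tendsto_coeff_rowsGF_mul_sqrt :
    Tendsto (fun n : ℕ => coeff (n + 1) rowsGF * √(Real.pi * (n + 1 : ℕ) ^ 3) /
      2 ^ (3 * (n + 1) - 2)) atTop (𝓝 1) := by
  have hW : ∀ n : ℕ, coeff (n + 1) rowsGF * √(Real.pi * (n + 1 : ℕ) ^ 3) / 2 ^ (3 * (n + 1) - 2) =
      √(Real.pi / ((2 - 1 / ((n : ℝ) + 1)) * Real.Wallis.W n)) := by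
    intro n
    have hcb : (n.centralBinom : ℝ) = (2 * n).factorial / (n.factorial : ℝ) ^ 2 := by
      rw [Nat.centralBinom, Nat.cast_choose ℝ (by lia), two_mul, Nat.add_sub_cancel, sq]
    have h1 : 2 - 1 / ((n : ℝ) + 1) = (2 * n + 1) / (n + 1) := by field_simp; ring
    have hx : 0 ≤ coeff (n + 1) rowsGF * √(Real.pi * (n + 1 : ℕ) ^ 3) / 2 ^ (3 * (n + 1) - 2) := by
      have := coeff_rowsGF_succ_pos n
      positivity
    rw [← Real.sqrt_sq hx, h1, Real.Wallis.W_eq_factorial_ratio, div_pow, mul_pow,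
      Real.sq_sqrt (by positivity), coeff_rowsGF_succ, hcb,
      show 3 * (n + 1) - 2 = n + 1 + 2 * n by lia, pow_add _ (n + 1), pow_mul _ 4, pow_mul _ 2 n]
    have h16 : ((2 : ℝ) ^ 4) ^ n = (2 ^ 2) ^ n * (2 ^ 2) ^ n := by rw [← mul_pow]; norm_num
    rw [h16]
    congr 1
    push_cast
    field_simp
  simp_rw [hW]
  have hpi := Real.pi_pos
  have h := ((tendsto_const_nhds (x := (2 : ℝ))).sub
    (tendsto_one_div_add_atTop_nhds_zero_nat (𝕜 := ℝ))).mul Real.Wallis.tendsto_W_nhds_pi_div_two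
  have h' := ((tendsto_const_nhds (x := Real.pi)).div h (by positivity)).sqrt
  convert! h' using 2
  rw [sub_zero, mul_div_cancel₀ _ two_ne_zero, div_self hpi.ne', Real.sqrt_one]

open PowerSeries in
theorem mk_false_rows_eq (f : ℕ → ℤ) (hf0 : f 0 = 0) (hf1 : f 1 = 1)
    (hf : ∀ n : ℕ, 2 ≤ n →
      f n = ∑ i ∈ Finset.Icc 1 (n - 1), ((2 : ℤ) ^ i * catalanC i - f i) * f (n - i)) :
    (mk fun n => (f n : ℝ)) = X + (rowsGF - mk fun n => (f n : ℝ)) * mk fun n => (f n : ℝ) := by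
  have hc : ∀ n, coeff n ((rowsGF - mk fun n => (f n : ℝ)) * mk fun n => (f n : ℝ)) =
      ((∑ i ∈ Finset.range (n + 1), ((2 : ℤ) ^ i * catalanC i - f i) * f (n - i) : ℤ) : ℝ) := by
    intro n
    rw [coeff_mul, Finset.Nat.sum_antidiagonal_eq_sum_range_succ_mk]
    simp [rowsGF]
  ext n
  rw [map_add, hc, coeff_mk, coeff_X]
  rcases n with _ | _ | n
  · simp [hf0]
  · simp [hf0, hf1, Finset.sum_range_succ, catalanC_zero]
  · rw [hf _ (by lia), Finset.sum_range_succ, Finset.sum_range_succ']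
    have : Finset.Icc 1 (n + 1 + 1 - 1) = Finset.Ico 1 (n + 2) := by ext; simp; lia
    rw [this, Finset.sum_Ico_eq_sum_range]
    simp [hf0, catalanC_zero, add_comm, show 1 + (n + 1) - (n + 2) = 0 by lia]

open Filter in
/-- `t n = 2^n C n - f n` (the number of true rows) is asymptotically
`((3 + √3)/6) * 2^(3n-2) / √(π n³)`: the ratio tends to `1` as `n → ∞`. -/
theorem true_rows_asymptotics (f : ℕ → ℤ) (hf0 : f 0 = 0) (hf1 : f 1 = 1)
    (hf : ∀ n : ℕ, 2 ≤ n →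
      f n = ∑ i ∈ Finset.Icc 1 (n - 1),
        ((2 : ℤ) ^ i * catalanC i - f i) * f (n - i))
    (t : ℕ → ℤ) (ht : ∀ n : ℕ, t n = 2 ^ n * catalanC n - f n) :
    Tendsto
      (fun n : ℕ => (t n : ℝ) * 6 * Real.sqrt (Real.pi * n ^ 3) /
        ((3 + Real.sqrt 3) * 2 ^ (3 * n - 2)))
      atTop (nhds 1) := by
  have hF := eq_sub_subst_catalanGF
    (by rw [← PowerSeries.coeff_zero_eq_constantCoeff_apply]; simp [hf0])
    (mk_false_rows_eq f hf0 hf1 hf)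
  have htn : ∀ n, (t n : ℝ) = 1 / 2 * PowerSeries.coeff n rowsGF +
      PowerSeries.coeff n (catalanGF.subst (PowerSeries.C (1 / 4 : ℝ) * rowsGF ^ 2)) := by
    intro n
    have h := congrArg (PowerSeries.coeff n) hF
    rw [PowerSeries.coeff_mk, map_sub, PowerSeries.coeff_C_mul] at h
    rw [ht]
    push_cast
    rw [h, rowsGF, PowerSeries.coeff_mk]
    ring
  rw [← tendsto_add_atTop_iff_nat 1]
  have h := (((tendsto_coeff_subst_catalanGF_div.const_add (1 / 2)).mul
    tendsto_coeff_rowsGF_mul_sqrt).const_mul (6 / (3 + √3)))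
  convert! h using 2 with n
  · have := (coeff_rowsGF_succ_pos n).ne'
    rw [htn]
    field_simp
  · field_simp
    ring
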